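/- Let q be a core (I,J)-coset, let s ∈ S∖J be such that Js := J ∪ {s} is finitary, and suppose ℓ(q̄·w_J·w_{Js}) < ℓ(q̄) − ℓ(w_J) + ℓ(w_{Js}) (i.e. the composition of q with the (J,Js)-coset W_J·W_{Js} is not reduced). Then: (1) ℓ(q̲·s) < ℓ(q̲); (2) the minimal length of an element of the (I,Js)-coset W_I·q̲·W_{Js} is strictly smaller than ℓ(q̲); (3) there is a reduced atomic expression (L_0,…,L_m; s_1,…,s_m) from I to J expressing q (x_m = q̄) whose last removed letter is t_m = s. -/

import Mathlib

namespace CoxeterAtoms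

variable {B : Type*} {W : Type*} [Group W] {M : CoxeterMatrix B}

/-- The standard parabolic subgroup `W_K` generated by the simple reflections indexed by `K`. -/
def par (cs : CoxeterSystem M W) (K : Set B) : Subgroup W :=
  Subgroup.closure (cs.simple '' K)

/-- `K` is finitary if `W_K` is finite. -/
def Finitary (cs : CoxeterSystem M W) (K : Set B) : Prop :=
  ((par cs K : Set W)).Finite

/-- The left coset `W_I · x`. -/
def lcos (cs : CoxeterSystem M W) (I : Set B) (x : W) : Set W :=
  {w | ∃ a ∈ par cs I, w = a * x}

/-- The right coset `x · W_J`. -/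
def rcos (cs : CoxeterSystem M W) (x : W) (J : Set B) : Set W :=
  {w | ∃ b ∈ par cs J, w = x * b}

/-- The double coset `W_I · x · W_J`. -/
def dcos (cs : CoxeterSystem M W) (I : Set B) (x : W) (J : Set B) : Set W :=
  {w | ∃ a ∈ par cs I, ∃ b ∈ par cs J, w = a * x * b}

/-- `x` is a minimal length element of its double coset `W_I · x · W_J`. -/
def IsMinRep (cs : CoxeterSystem M W) (I : Set B) (x : W) (J : Set B) : Prop :=
  ∀ w ∈ dcos cs I x J, cs.length x ≤ cs.length w

/-- `y` is a maximal length element of the set `p`. -/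
def IsMaxOf (cs : CoxeterSystem M W) (p : Set W) (y : W) : Prop :=
  y ∈ p ∧ ∀ w ∈ p, cs.length w ≤ cs.length y

/-- `y` is the longest element of the standard parabolic subgroup `W_K`. -/
def IsLongest (cs : CoxeterSystem M W) (K : Set B) (y : W) : Prop :=
  y ∈ par cs K ∧ ∀ w ∈ par cs K, cs.length w ≤ cs.length y

/-- The double coset `W_I · x · W_J` is core: `W_I·x = W_I·x·W_J = x·W_J`. -/
def IsCore (cs : CoxeterSystem M W) (I : Set B) (x : W) (J : Set B) : Prop :=
  lcos cs I x = dcos cs I x J ∧ dcos cs I x J = rcos cs x J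

/-- A reduced atomic expression `(L_0,…,L_m; s_1,…,s_m)` of width `m` from `I` to `J`,
together with the associated data: the removed letters `t_i`, the longest elements
`w_{L_i}` and `w_{K_i}` (where `K_i = L_{i-1} ∪ {s_i}`), and the partial products `x_i`. -/
structure RAtomExpr (cs : CoxeterSystem M W) (I J : Set B) (m : ℕ) where
  Lset : ℕ → Set B
  letter : ℕ → B
  tletter : ℕ → B
  wL : ℕ → W
  wK : ℕ → W
  x : ℕ → W
  hL0 : Lset 0 = I
  hLm : Lset m = J
  hwL : ∀ i ≤ m, IsLongest cs (Lset i) (wL i)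
  hmem : ∀ i, 1 ≤ i → i ≤ m → letter i ∉ Lset (i - 1)
  hfinK : ∀ i, 1 ≤ i → i ≤ m → Finitary cs (Lset (i - 1) ∪ {letter i})
  hwK : ∀ i, 1 ≤ i → i ≤ m → IsLongest cs (Lset (i - 1) ∪ {letter i}) (wK i)
  ht : ∀ i, 1 ≤ i → i ≤ m →
    cs.simple (tletter i) = wK i * cs.simple (letter i) * wK i
  hLi : ∀ i, 1 ≤ i → i ≤ m → Lset i = (Lset (i - 1) ∪ {letter i}) \ {tletter i}
  hx0 : x 0 = wL 0
  hx : ∀ i, 1 ≤ i → i ≤ m → x i = x (i - 1) * wL (i - 1) * wK i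
  hred : ∀ i, 1 ≤ i → i ≤ m →
    (cs.length (x i) : ℤ) =
      (cs.length (x (i - 1)) : ℤ) - cs.length (wL (i - 1)) + cs.length (wK i)

section Injectivity
open Module Polynomial.Chebyshev

/-- Evaluation of Chebyshev `S` at `2 cos θ`. -/
theorem S_eval_cos (n : ℤ) (θ : ℝ) :
    (S ℝ n).eval (2 * Real.cos θ) * Real.sin θ = Real.sin ((n + 1) * θ) := by
  rw [← U_real_cos, ← S_comp_two_mul_X]
  simp

/-- Simple coroot functional of the geometric representation. -/
noncomputable def coroot (M : CoxeterMatrix B) (i : B) : Dual ℝ (B →₀ ℝ) :=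
  Finsupp.linearCombination ℝ (fun j => -2 * Real.cos (Real.pi / M i j))

theorem coroot_single (i j : B) :
    coroot M i (Finsupp.single j 1) = -2 * Real.cos (Real.pi / M i j) := by
  simp [coroot]

theorem coroot_self (i : B) : coroot M i (Finsupp.single i 1) = 2 := by
  rw [coroot_single]; simp

/-- Generators of the geometric representation. -/
noncomputable def geo (M : CoxeterMatrix B) (i : B) : (B →₀ ℝ) ≃ₗ[ℝ] (B →₀ ℝ) :=
  reflection (coroot_self (M := M) i)

theorem geo_liftable : M.IsLiftable (geo M) := by
  intro i j
  by_cases hij : i = j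
  · subst hij
    rw [M.diagonal, pow_one]
    ext1 z
    simpa [geo] using involutive_reflection (coroot_self (M := M) i) z
  by_cases h0 : M i j = 0
  · rw [h0, pow_zero]
  have h1 : M i j ≠ 1 := M.off_diagonal i j hij
  set m := M i j with hm
  have e1 : coroot M i (Finsupp.single j 1) = -2 * Real.cos (Real.pi / m) := coroot_single i j
  have e2 : coroot M j (Finsupp.single i 1) = -2 * Real.cos (Real.pi / m) := by
    rw [coroot_single, M.symmetric j i]
  ext1 z
  have ht : (2 * Real.cos (2 * (Real.pi / m)) : ℝ) =
      coroot M i (Finsupp.single j 1) * coroot M j (Finsupp.single i 1) - 2 := by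
    rw [e1, e2, Real.cos_two_mul]; ring
  have key := reflection_mul_reflection_pow_apply (coroot_self (M := M) i)
    (coroot_self (M := M) j) m z _ ht
  rw [geo, geo, key, e1, e2]
  by_cases h2 : m = 2
  · have hc : Real.cos (2 * (Real.pi / 2)) = -1 := by
      rw [mul_div_cancel₀ _ two_ne_zero, Real.cos_pi]
    rw [h2]
    norm_num [hc]
    abel
  have hm3 : 3 ≤ m := by omega
  have hm3' : (3 : ℝ) ≤ m := by exact_mod_cast hm3
  have hsin : Real.sin (2 * (Real.pi / m)) ≠ 0 := by
    apply ne_of_gt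
    have := Real.pi_pos
    apply Real.sin_pos_of_pos_of_lt_pi
    · positivity
    · rw [← mul_div_assoc, div_lt_iff₀ (by linarith)]; nlinarith
  have hθ : (m : ℝ) * (Real.pi / m) = Real.pi := by field_simp
  rcases Nat.even_or_odd' m with ⟨k, hk | hk⟩
  · have i1 : ((m : ℤ) - 2) / 2 = k - 1 := by omega
    have i2 : ((m : ℤ) - 1) / 2 = k - 1 := by omega
    have hk' : (m : ℝ) = 2 * k := by exact_mod_cast hk
    have z1 : (S ℝ ((k : ℤ) - 1)).eval (2 * Real.cos (2 * (Real.pi / m))) = 0 := by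
      have := S_eval_cos ((k : ℤ) - 1) (2 * (Real.pi / m))
      have e : (((k : ℤ) - 1 : ℤ) + 1 : ℝ) * (2 * (Real.pi / m)) = Real.pi := by
        push_cast; linear_combination hθ - (Real.pi / m) * hk'
      rw [e, Real.sin_pi] at this
      exact (mul_eq_zero.mp this).resolve_right hsin
    rw [i1, i2, z1]; simp
  · have i1 : ((m : ℤ) - 2) / 2 = k - 1 := by omega
    have i2 : ((m : ℤ) - 1) / 2 = k := by omega
    have i3 : ((m : ℤ) - 3) / 2 = k - 1 := by omega
    have i4 : (m : ℤ) / 2 = k := by omega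
    have hk' : (m : ℝ) = 2 * k + 1 := by exact_mod_cast hk
    have z1 : (S ℝ (k : ℤ)).eval (2 * Real.cos (2 * (Real.pi / m))) +
        (S ℝ ((k : ℤ) - 1)).eval (2 * Real.cos (2 * (Real.pi / m))) = 0 := by
      have a := S_eval_cos ((k : ℤ) - 1) (2 * (Real.pi / m))
      have b := S_eval_cos (k : ℤ) (2 * (Real.pi / m))
      have e : (((k : ℤ) : ℝ) + 1) * (2 * (Real.pi / m)) =
          2 * Real.pi - (((k : ℤ) - 1 : ℤ) + 1 : ℝ) * (2 * (Real.pi / m)) := by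
        push_cast; linear_combination 2 * hθ - 2 * (Real.pi / m) * hk'
      rw [e, Real.sin_two_pi_sub] at b
      have : ((S ℝ (k : ℤ)).eval (2 * Real.cos (2 * (Real.pi / m))) +
        (S ℝ ((k : ℤ) - 1)).eval (2 * Real.cos (2 * (Real.pi / m)))) *
          Real.sin (2 * (Real.pi / m)) = 0 := by
        rw [add_mul, a, b]; ring
      exact (mul_eq_zero.mp this).resolve_right hsin
    rw [i1, i2, i3, i4, z1]; simp

theorem simple_inj (cs : CoxeterSystem M W) : Function.Injective cs.simple := by
  intro i j h
  by_contra hij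
  have h2 : geo M i = geo M j := by
    rw [← cs.lift_apply_simple geo_liftable i, h, cs.lift_apply_simple]
  have h3 := congrArg (fun φ => φ (Finsupp.single i (1:ℝ)) i) h2
  simp only [geo, reflection_apply, coroot_self] at h3
  simp [hij] at h3

end Injectivity

section Exchange

open Classical in
/-- The sign-twisted conjugation by a simple reflection. -/
noncomputable def twist (cs : CoxeterSystem M W) (i : B) (p : W × ZMod 2) : W × ZMod 2 :=
  (cs.simple i * p.1 * cs.simple i, p.2 + if p.1 = cs.simple i then 1 else 0)

/-- The same map as an element of the monoid of self maps. -/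
noncomputable def twistEnd (cs : CoxeterSystem M W) (i : B) : Function.End (W × ZMod 2) :=
  twist cs i

open Classical in
theorem twist_pow (cs : CoxeterSystem M W) (i j : B) (n : ℕ) (t : W) (e : ZMod 2) :
    ((twistEnd cs i * twistEnd cs j) ^ n) (t, e) =
      ((cs.simple i * cs.simple j) ^ n * t * (cs.simple j * cs.simple i) ^ n,
        e + ∑ r ∈ Finset.range (2 * n),
          if t = cs.simple j * (cs.simple i * cs.simple j) ^ r then 1 else 0) := by
  set a := cs.simple i with ha
  set b := cs.simple j with hb
  have haa : a * a = 1 := cs.simple_mul_simple_self i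
  have hbb : b * b = 1 := cs.simple_mul_simple_self j
  have hinv : (b * a) = (a * b)⁻¹ := by
    simp [ha, hb]
  have hconj : ∀ n : ℕ, ((a * b) ^ n)⁻¹ * b = b * (a * b) ^ n := by
    intro n
    induction n with
    | zero => simp
    | succ n ih =>
      calc ((a * b) ^ (n + 1))⁻¹ * b = (a * b)⁻¹ * (((a * b) ^ n)⁻¹ * b) := by
            rw [pow_succ, mul_inv_rev, mul_assoc]
        _ = b * a * (b * (a * b) ^ n) := by rw [ih, hinv]
        _ = b * (a * b) ^ (n + 1) := by rw [pow_succ']; simp only [mul_assoc]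
  induction n with
  | zero => simp; rfl
  | succ n ih =>
    rw [pow_succ']
    change twist cs i (twist cs j (((twistEnd cs i * twistEnd cs j) ^ n) (t, e))) = _
    rw [ih]
    simp only [twist, ← ha, ← hb]
    rw [show 2 * (n + 1) = 2 * n + 1 + 1 by ring, Finset.sum_range_succ, Finset.sum_range_succ]
    have c1 : (a * b) ^ n * t * (b * a) ^ n = b ↔ t = b * (a * b) ^ (2 * n) := by
      rw [hinv, inv_pow, mul_inv_eq_iff_eq_mul, ← eq_inv_mul_iff_mul_eq, ← mul_assoc, hconj,
        mul_assoc, ← pow_add, two_mul]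
    have c2 : b * ((a * b) ^ n * t * (b * a) ^ n) * b = a ↔ t = b * (a * b) ^ (2 * n + 1) := by
      have : b * ((a * b) ^ n * t * (b * a) ^ n) * b = a ↔
          ((a * b) ^ n * t * (b * a) ^ n) = b * (a * b) := by
        generalize (a * b) ^ n * t * (b * a) ^ n = u
        constructor
        · intro h
          calc u = (b * b) * u * (b * b) := by simp [hbb]
            _ = b * ((b * u * b) * b) := by simp only [mul_assoc]
            _ = _ := by rw [h]
        · intro h
          calc b * u * b = (b * b) * a * (b * b) := by rw [h]; simp only [mul_assoc]
            _ = _ := by simp [hbb]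
      rw [this, hinv, inv_pow, mul_inv_eq_iff_eq_mul, ← eq_inv_mul_iff_mul_eq, ← mul_assoc,
        ← mul_assoc, hconj, mul_assoc, mul_assoc, ← pow_succ', ← pow_add,
        show n + (n + 1) = 2 * n + 1 by ring]
    simp only [c1, c2]
    refine Prod.ext ?_ ?_
    · simp only [pow_succ' (a * b), pow_succ (b * a), mul_assoc]
    · simp only [add_assoc]

theorem twist_liftable (cs : CoxeterSystem M W) : M.IsLiftable (twistEnd cs) := by
  classical
  intro i j
  funext p
  obtain ⟨t, e⟩ := p
  rw [twist_pow]
  change _ = (t, e)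
  have h1 : (cs.simple i * cs.simple j) ^ M i j = 1 := cs.simple_mul_simple_pow i j
  have h2 : (cs.simple j * cs.simple i) ^ M i j = 1 := cs.simple_mul_simple_pow' i j
  rw [h1, h2, two_mul, Finset.sum_range_add]
  simp only [pow_add, h1, one_mul, mul_one]
  rw [CharTwo.add_self_eq_zero, add_zero]

open Classical in
/-- Action of a word: the sign counts occurrences in the right inversion sequence. -/
theorem lift_twist_word (cs : CoxeterSystem M W) (ω : List B) (t : W) (e : ZMod 2) :
    cs.lift ⟨twistEnd cs, twist_liftable cs⟩ (cs.wordProd ω) (t, e) =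
      (cs.wordProd ω * t * (cs.wordProd ω)⁻¹, e + ((cs.rightInvSeq ω).count t : ℕ)) := by
  induction ω with
  | nil => simp; rfl
  | cons i ω ih =>
    rw [cs.wordProd_cons, map_mul, cs.lift_apply_simple]
    change twist cs i (cs.lift ⟨twistEnd cs, twist_liftable cs⟩ (cs.wordProd ω) (t, e)) = _
    rw [ih]
    simp only [twist, CoxeterSystem.rightInvSeq, List.count_cons]
    refine Prod.ext ?_ ?_
    · simp [mul_assoc]
    · have : (cs.wordProd ω * t * (cs.wordProd ω)⁻¹ = cs.simple i) ↔
          ((cs.wordProd ω)⁻¹ * cs.simple i * cs.wordProd ω = t) := by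
        constructor
        · intro h; rw [← h]; group
        · intro h; rw [← h]; group
      simp only [this, beq_iff_eq]
      push_cast
      rw [add_assoc]

/-- The exchange condition. -/
theorem exchange (cs : CoxeterSystem M W) (ω : List B) (i : B)
    (h : cs.length (cs.wordProd ω * cs.simple i) < cs.length (cs.wordProd ω)) :
    ∃ j, j < ω.length ∧ cs.wordProd ω * cs.simple i = cs.wordProd (ω.eraseIdx j) := by
  classical
  have hmem : cs.simple i ∈ cs.rightInvSeq ω := by
    by_contra hn
    have hc := List.count_eq_zero.mpr hn
    obtain ⟨ω', hω', he⟩ := cs.exists_isReduced (cs.wordProd ω * cs.simple i)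
    have e1 := lift_twist_word cs ω' (cs.simple i) 0
    rw [← he, map_mul, cs.lift_apply_simple] at e1
    change cs.lift ⟨twistEnd cs, twist_liftable cs⟩ (cs.wordProd ω)
      (twist cs i (cs.simple i, 0)) = _ at e1
    have e0 : twist cs i (cs.simple i, 0) = (cs.simple i, 1) := by
      simp [twist]
    rw [e0, lift_twist_word, hc] at e1
    have e2 := congrArg Prod.snd e1
    simp only [Nat.cast_zero, add_zero, zero_add] at e2
    have hmem' : cs.simple i ∈ cs.rightInvSeq ω' := by
      by_contra hn'
      rw [List.count_eq_zero.mpr hn'] at e2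
      simp at e2
    have := (cs.isRightInversion_of_mem_rightInvSeq hω' hmem').2
    rw [← he] at this
    simp only [cs.simple_mul_simple_cancel_right] at this
    omega
  obtain ⟨j, hj, hje⟩ := List.mem_iff_getElem.mp hmem
  refine ⟨j, by simpa using hj, ?_⟩
  rw [← cs.wordProd_mul_getD_rightInvSeq, List.getD_eq_getElem _ _ hj, hje]

end Exchange

section Parabolic

theorem simple_mem_par (cs : CoxeterSystem M W) {K : Set B} {k : B} (hk : k ∈ K) :
    cs.simple k ∈ par cs K :=
  Subgroup.subset_closure ⟨k, hk, rfl⟩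

theorem par_mono (cs : CoxeterSystem M W) {J K : Set B} (h : J ⊆ K) : par cs J ≤ par cs K :=
  Subgroup.closure_mono (Set.image_mono h)

/-- Every element of `W_K` has a reduced word with letters in `K`. -/
theorem exists_word (cs : CoxeterSystem M W) {K : Set B} {v : W} (hv : v ∈ par cs K) :
    ∃ ω : List B, (∀ i ∈ ω, i ∈ K) ∧ cs.wordProd ω = v ∧ cs.length v = ω.length := by
  have step : ∀ (x : W) (k : B), k ∈ K →
      (∃ ω : List B, (∀ i ∈ ω, i ∈ K) ∧ cs.wordProd ω = x ∧ cs.length x = ω.length) →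
      ∃ ω : List B, (∀ i ∈ ω, i ∈ K) ∧ cs.wordProd ω = x * cs.simple k ∧
        cs.length (x * cs.simple k) = ω.length := by
    rintro x k hk ⟨ω, h1, h2, h3⟩
    rcases cs.length_mul_simple x k with h | h
    · refine ⟨ω ++ [k], ?_, ?_, ?_⟩
      · intro i hi
        rcases List.mem_append.mp hi with hi | hi
        · exact h1 i hi
        · rw [List.mem_singleton.mp hi]; exact hk
      · rw [cs.wordProd_append, h2, cs.wordProd_singleton]
      · simp [h, h3]
    · obtain ⟨j, hj, he⟩ := exchange cs ω k (by rw [h2]; omega)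
      refine ⟨ω.eraseIdx j, fun i hi => h1 i (List.mem_of_mem_eraseIdx hi), ?_, ?_⟩
      · rw [← he, h2]
      · have := List.length_eraseIdx_add_one hj
        omega
  refine Subgroup.closure_induction_right
    (p := fun v _ => ∃ ω : List B, (∀ i ∈ ω, i ∈ K) ∧ cs.wordProd ω = v ∧ cs.length v = ω.length)
    ⟨[], by simp, by simp, by simp⟩ ?_ ?_ hv
  · rintro x _ y ⟨k, hk, rfl⟩ ih
    exact step x k hk ih
  · rintro x _ y ⟨k, hk, rfl⟩ ih
    rw [cs.inv_simple]
    exact step x k hk ih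

/-- Right induction over reduced words in `W_K`. -/
theorem par_induction (cs : CoxeterSystem M W) {K : Set B} (p : W → Prop) (h1 : p 1)
    (hs : ∀ v k, v ∈ par cs K → k ∈ K → cs.length (v * cs.simple k) = cs.length v + 1 → p v →
      p (v * cs.simple k)) {v : W} (hv : v ∈ par cs K) : p v := by
  obtain ⟨ω, ha, hb, hc⟩ := exists_word cs hv
  have hall : ∀ i ∈ ω, i ∈ K := ha
  have hred : cs.IsReduced ω := by rw [CoxeterSystem.IsReduced, hb, hc]
  have : ∀ ω : List B, (∀ i ∈ ω, i ∈ K) → cs.IsReduced ω →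
      cs.wordProd ω ∈ par cs K ∧ p (cs.wordProd ω) := by
    intro ω
    induction ω using List.reverseRecOn with
    | nil => intro _ _; rw [cs.wordProd_nil]; exact ⟨Subgroup.one_mem _, h1⟩
    | append_singleton ω k ih =>
      intro hK hr
      have hr' : cs.IsReduced ω := by
        have := hr.take ω.length
        simpa using this
      obtain ⟨i1, i2⟩ := ih (fun i hi => hK i (by simp [hi])) hr'
      have hk : k ∈ K := hK k (by simp)
      rw [cs.wordProd_append, cs.wordProd_singleton]
      refine ⟨Subgroup.mul_mem _ i1 (simple_mem_par cs hk), hs _ _ i1 hk ?_ i2⟩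
      have e1 := hr.eq
      have e2 := hr'.eq
      rw [cs.wordProd_append, cs.wordProd_singleton] at e1
      simp at e1
      omega
  rw [← hb]
  exact (this ω hall hred).2

/-- A coset-minimal element multiplies additively. -/
theorem add_of_cosetMin (cs : CoxeterSystem M W) {K : Set B} {x : W}
    (hx : ∀ v ∈ par cs K, cs.length x ≤ cs.length (x * v)) {v : W} (hv : v ∈ par cs K) :
    cs.length (x * v) = cs.length x + cs.length v := by
  refine par_induction cs (fun v => cs.length (x * v) = cs.length x + cs.length v) (by simp) ?_ hv
  intro v k hv hk hl ih
  rw [← mul_assoc]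
  rcases cs.length_mul_simple (x * v) k with h | h
  · omega
  exfalso
  obtain ⟨ωx, rx, ex⟩ := cs.exists_isReduced x
  obtain ⟨ωv, rv, ev⟩ := cs.exists_isReduced v
  have hp : cs.wordProd (ωx ++ ωv) = x * v := by rw [cs.wordProd_append, ← ex, ← ev]
  obtain ⟨j, hj, he⟩ := exchange cs (ωx ++ ωv) k (by rw [hp]; omega)
  rw [hp] at he
  rw [List.eraseIdx_append] at he
  have lx : cs.length x = ωx.length := by rw [ex, rx.eq]
  have lv : cs.length v = ωv.length := by rw [ev, rv.eq]
  split_ifs at he with hlt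
  · rw [cs.wordProd_append, ← ev] at he
    have := hx (v * cs.simple k * v⁻¹)
      (Subgroup.mul_mem _ (Subgroup.mul_mem _ hv (simple_mem_par cs hk)) (Subgroup.inv_mem _ hv))
    have e2 : x * (v * cs.simple k * v⁻¹) = cs.wordProd (ωx.eraseIdx j) := by
      rw [← mul_assoc, ← mul_assoc, he]; simp
    rw [e2] at this
    have h3 := cs.length_wordProd_le (ωx.eraseIdx j)
    have h4 := List.length_eraseIdx_add_one hlt
    omega
  · rw [cs.wordProd_append, ← ex, mul_assoc] at he
    have e2 := mul_left_cancel he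
    have h3 := cs.length_wordProd_le (ωv.eraseIdx (j - ωx.length))
    rw [← e2] at h3
    have hj' : j - ωx.length < ωv.length := by
      rw [List.length_append] at hj; omega
    have h4 := List.length_eraseIdx_add_one hj'
    omega

/-- A nontrivial element of `W_K` has a right descent in `K`. -/
theorem exists_descent (cs : CoxeterSystem M W) {K : Set B} {v : W} (hv : v ∈ par cs K)
    (h1 : v ≠ 1) : ∃ k ∈ K, cs.length (v * cs.simple k) < cs.length v := by
  revert h1
  refine par_induction cs (fun v => v ≠ 1 → ∃ k ∈ K, cs.length (v * cs.simple k) < cs.length v)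
    (by simp) ?_ hv
  intro v k _ hk hl _ _
  refine ⟨k, hk, ?_⟩
  rw [cs.simple_mul_simple_cancel_right]
  omega

/-- Locally minimal implies additive. -/
theorem add_of_localMin (cs : CoxeterSystem M W) {K : Set B} {x : W}
    (hx : ∀ k ∈ K, cs.length x < cs.length (x * cs.simple k)) {v : W} (hv : v ∈ par cs K) :
    cs.length (x * v) = cs.length x + cs.length v := by
  obtain ⟨u, hu, hmin⟩ : ∃ u ∈ par cs K, ∀ v ∈ par cs K,
      cs.length (x * u) ≤ cs.length (x * v) := by
    have hne : ((par cs K : Subgroup W) : Set W).Nonempty := ⟨1, Subgroup.one_mem _⟩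
    exact ⟨Function.argminOn (fun v => cs.length (x * v)) _ hne,
      Function.argminOn_mem _ _ hne, fun v hv =>
        Function.argminOn_le (fun v => cs.length (x * v)) _ hv⟩
  have hadd : ∀ v ∈ par cs K, cs.length (x * u * v) = cs.length (x * u) + cs.length v := by
    intro v hv
    refine add_of_cosetMin cs (fun v hv => ?_) hv
    rw [mul_assoc]
    exact hmin _ (Subgroup.mul_mem _ hu hv)
  by_cases h1 : u⁻¹ = 1
  · have : u = 1 := by simpa using h1
    subst this
    simpa using hadd v hv
  · exfalso
    obtain ⟨k, hk, hd⟩ := exists_descent cs (Subgroup.inv_mem _ hu) h1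
    have e1 := hadd _ (Subgroup.inv_mem _ hu)
    have e2 := hadd _ (Subgroup.mul_mem _ (Subgroup.inv_mem _ hu) (simple_mem_par cs hk))
    rw [mul_assoc x u, mul_inv_cancel, mul_one] at e1
    rw [← mul_assoc, mul_assoc x u, mul_inv_cancel, mul_one] at e2
    have := hx k hk
    omega

/-- If all of `K` are right descents of `z`, lengths subtract. -/
theorem sub_of_descents (cs : CoxeterSystem M W) {K : Set B} {z : W}
    (hz : ∀ k ∈ K, cs.length (z * cs.simple k) < cs.length z) {v : W} (hv : v ∈ par cs K) :
    cs.length (z * v) + cs.length v = cs.length z := by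
  have key : ∀ v ∈ par cs K, cs.length (z * v⁻¹) + cs.length v = cs.length z := by
    intro v hv
    refine par_induction cs (fun v => cs.length (z * v⁻¹) + cs.length v = cs.length z)
      (by simp) ?_ hv
    intro v k _ hk hl ih
    rw [mul_inv_rev, cs.inv_simple, hl]
    obtain ⟨ωx, rx, ex⟩ := cs.exists_isReduced (z * v⁻¹)
    obtain ⟨ωv, rv, ev⟩ := cs.exists_isReduced v
    have hp : cs.wordProd (ωx ++ ωv) = z := by
      rw [cs.wordProd_append, ← ex, ← ev]; simp
    have hzk := hz k hk
    obtain ⟨j, hj, he⟩ := exchange cs (ωx ++ ωv) k (by rw [hp]; exact hzk)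
    rw [hp, List.eraseIdx_append] at he
    have lx : cs.length (z * v⁻¹) = ωx.length := by rw [ex, rx.eq]
    have lv : cs.length v = ωv.length := by rw [ev, rv.eq]
    split_ifs at he with hlt
    · rw [cs.wordProd_append, ← ev] at he
      have e2 : z * (cs.simple k * v⁻¹) = cs.wordProd (ωx.eraseIdx j) := by
        rw [← mul_assoc, he]; simp
      have h3 := cs.length_wordProd_le (ωx.eraseIdx j)
      have h4 := List.length_eraseIdx_add_one hlt
      have h5 := cs.length_le_length_mul_add_right z (cs.simple k * v⁻¹)
      have h6 : cs.length (cs.simple k * v⁻¹) = cs.length v + 1 := by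
        rw [← hl, ← cs.length_inv (v * cs.simple k), mul_inv_rev, cs.inv_simple]
      rw [e2] at h5 ⊢
      omega
    · exfalso
      rw [cs.wordProd_append, ← ex] at he
      have e2 : v * cs.simple k = cs.wordProd (ωv.eraseIdx (j - ωx.length)) := by
        have : z * cs.simple k = (z * v⁻¹) * (v * cs.simple k) := by group
        rw [this] at he
        exact mul_left_cancel he
      have h3 := cs.length_wordProd_le (ωv.eraseIdx (j - ωx.length))
      rw [← e2] at h3
      have hj' : j - ωx.length < ωv.length := by
        rw [List.length_append] at hj; omega
      have h4 := List.length_eraseIdx_add_one hj'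
      omega
  have := key v⁻¹ (Subgroup.inv_mem _ hv)
  rwa [inv_inv, cs.length_inv] at this

theorem longest_sub (cs : CoxeterSystem M W) {K : Set B} {w : W} (hw : IsLongest cs K w) {v : W}
    (hv : v ∈ par cs K) : cs.length (w * v) + cs.length v = cs.length w := by
  refine sub_of_descents cs (fun k hk => ?_) hv
  have h1 := hw.2 _ (Subgroup.mul_mem _ hw.1 (simple_mem_par cs hk))
  have h2 := cs.length_mul_simple_ne w k
  omega

theorem longest_mul_self (cs : CoxeterSystem M W) {K : Set B} {w : W} (hw : IsLongest cs K w) :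
    w * w = 1 := by
  have := longest_sub cs hw hw.1
  rw [← cs.length_eq_zero_iff]
  omega

theorem longest_unique (cs : CoxeterSystem M W) {K : Set B} {w w' : W} (hw : IsLongest cs K w)
    (hw' : w' ∈ par cs K) (hl : cs.length w ≤ cs.length w') : w' = w := by
  have h1 := longest_sub cs hw hw'
  have h2 : w * w' = 1 := by
    rw [← cs.length_eq_zero_iff]
    omega
  exact mul_left_cancel (h2.trans (longest_mul_self cs hw).symm)

theorem longest_inv (cs : CoxeterSystem M W) {K : Set B} {w : W} (hw : IsLongest cs K w) :
    w⁻¹ = w := inv_eq_of_mul_eq_one_left (longest_mul_self cs hw)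

theorem exists_longest (cs : CoxeterSystem M W) {K : Set B} (hK : Finitary cs K) :
    ∃ w, IsLongest cs K w := by
  obtain ⟨w, hw, hm⟩ := Set.exists_max_image _ cs.length hK ⟨1, Subgroup.one_mem _⟩
  exact ⟨w, hw, hm⟩

theorem simple_of_length_one (cs : CoxeterSystem M W) {K : Set B} {v : W} (hv : v ∈ par cs K)
    (h : cs.length v = 1) : ∃ k ∈ K, cs.simple k = v := by
  obtain ⟨ω, h1, h2, h3⟩ := exists_word cs hv
  rw [h] at h3
  obtain ⟨k, rfl⟩ := List.length_eq_one_iff.mp h3.symm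
  exact ⟨k, h1 k (by simp), by simpa using h2⟩

theorem mem_of_simple_mem_par (cs : CoxeterSystem M W) {K : Set B} {k : B}
    (h : cs.simple k ∈ par cs K) : k ∈ K := by
  obtain ⟨k', hk', he⟩ := simple_of_length_one cs h (cs.length_simple k)
  rwa [← simple_inj cs he]

theorem finite_of_finitary (cs : CoxeterSystem M W) {K : Set B} (hK : Finitary cs K) :
    K.Finite := by
  refine Set.Finite.of_finite_image (f := cs.simple) (hK.subset ?_) (simple_inj cs).injOn
  rintro _ ⟨k, hk, rfl⟩
  exact simple_mem_par cs hk

theorem finitary_of_bounded (cs : CoxeterSystem M W) {K : Set B} (hK : K.Finite) (N : ℕ)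
    (hb : ∀ v ∈ par cs K, cs.length v ≤ N) : Finitary cs K := by
  have : Finite K := hK
  have hfin := List.finite_length_le K N
  refine (hfin.image (fun l : List K => cs.wordProd (l.map Subtype.val))).subset ?_
  intro v hv
  obtain ⟨ω, h1, h2, h3⟩ := exists_word cs hv
  refine ⟨ω.attach.map (fun i => ⟨i.1, h1 i.1 i.2⟩), ?_, ?_⟩
  · simpa [← h3] using hb v hv
  · simp only [List.map_map]
    rw [← h2]
    congr 1
    conv_rhs => rw [← List.attach_map_subtype_val ω]
    rfl

/-- Conjugation by the longest element permutes the simple reflections. -/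
theorem longest_conj (cs : CoxeterSystem M W) {K : Set B} {w : W} (hw : IsLongest cs K w) {k : B}
    (hk : k ∈ K) : ∃ k' ∈ K, cs.simple k' = w * cs.simple k * w := by
  have hs := simple_mem_par cs hk
  refine simple_of_length_one cs (Subgroup.mul_mem _ (Subgroup.mul_mem _ hw.1 hs) hw.1) ?_
  have h1 := longest_sub cs hw (Subgroup.mul_mem _ hs hw.1)
  have h2 := longest_sub cs hw hs
  rw [← cs.length_inv (w * cs.simple k), mul_inv_rev, cs.inv_simple, longest_inv cs hw,
    cs.length_simple] at h2
  rw [mul_assoc]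
  omega

end Parabolic

section Core

/-- Working form: `x` is the minimal element of a core `(I,J)`-coset. -/
def Cor (cs : CoxeterSystem M W) (I : Set B) (x : W) (J : Set B) : Prop :=
  (∀ v ∈ par cs J, cs.length (x * v) = cs.length x + cs.length v) ∧
  (∀ v ∈ par cs J, x * v * x⁻¹ ∈ par cs I) ∧ (∀ u ∈ par cs I, x⁻¹ * u * x ∈ par cs J)

theorem cor_of_core (cs : CoxeterSystem M W) {I J : Set B} {x : W} (hmin : IsMinRep cs I x J)
    (hcore : IsCore cs I x J) : Cor cs I x J := by
  have heq : lcos cs I x = rcos cs x J := hcore.1.trans hcore.2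
  refine ⟨fun v hv => add_of_cosetMin cs (fun v hv => ?_) hv, fun v hv => ?_, fun u hu => ?_⟩
  · exact hmin _ ⟨1, Subgroup.one_mem _, v, hv, by simp⟩
  · have : x * v ∈ lcos cs I x := by rw [heq]; exact ⟨v, hv, rfl⟩
    obtain ⟨a, ha, he⟩ := this
    rw [he]; simpa using ha
  · have : u * x ∈ rcos cs x J := by rw [← heq]; exact ⟨u, hu, rfl⟩
    obtain ⟨a, ha, he⟩ := this
    rw [mul_assoc, he]; simpa using ha

theorem cor_left_add (cs : CoxeterSystem M W) {I J : Set B} {x : W} (h : Cor cs I x J) {u : W}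
    (hu : u ∈ par cs I) : cs.length (u * x) = cs.length u + cs.length x := by
  have h1 : ∀ u ∈ par cs I, cs.length x⁻¹ ≤ cs.length (x⁻¹ * u) := by
    intro u hu
    have e : x⁻¹ * u = (x * (x⁻¹ * u⁻¹ * x))⁻¹ := by group
    rw [e, cs.length_inv, cs.length_inv, h.1 _ (h.2.2 _ (Subgroup.inv_mem _ hu))]
    omega
  have h2 := add_of_cosetMin cs h1 (Subgroup.inv_mem _ hu)
  rw [← mul_inv_rev, cs.length_inv, cs.length_inv, cs.length_inv] at h2
  omega

/-- All of `J ∪ {s}` are right descents of the maximal element `x w_J`. -/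
theorem cor_descents (cs : CoxeterSystem M W) {I J : Set B} {x wJ : W} {s : B}
    (h : Cor cs I x J) (hw : IsLongest cs J wJ) (hs : cs.length (x * cs.simple s) < cs.length x) :
    ∀ k ∈ J ∪ {s}, cs.length (x * wJ * cs.simple k) < cs.length (x * wJ) := by
  rintro k (hk | hk)
  · have hks := simple_mem_par cs hk
    have h1 := longest_sub cs hw hks
    rw [cs.length_simple] at h1
    rw [mul_assoc, h.1 _ (Subgroup.mul_mem _ hw.1 hks), h.1 _ hw.1]
    omega
  · rw [Set.mem_singleton_iff.mp hk]
    have e : x * wJ = (x * wJ * x⁻¹) * x := by group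
    have h1 := cor_left_add cs h (h.2.1 _ hw.1)
    have h2 := cs.length_mul_le (x * wJ * x⁻¹) (x * cs.simple s)
    rw [← mul_assoc] at h2
    rw [e]
    omega

theorem not_mem_of_descent (cs : CoxeterSystem M W) {I J : Set B} {x : W} {s : B}
    (h : Cor cs I x J) (hs : cs.length (x * cs.simple s) < cs.length x) : s ∉ J := by
  intro hJ
  have := h.1 _ (simple_mem_par cs hJ)
  omega

/-- Conjugation by `w_K` exchanges the two maximal parabolic subgroups. -/
theorem conj_par (cs : CoxeterSystem M W) {K : Set B} {w : W} (hw : IsLongest cs K w) {s s' : B}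
    (he : cs.simple s' = w * cs.simple s * w) {v : W} (hv : v ∈ par cs (K \ {s})) :
    w * v * w ∈ par cs (K \ {s'}) := by
  have hww := longest_mul_self cs hw
  have hle : par cs (K \ {s}) ≤ (par cs (K \ {s'})).comap (MulAut.conj w).toMonoidHom := by
    rw [par, Subgroup.closure_le]
    rintro _ ⟨k, ⟨hk, hks⟩, rfl⟩
    obtain ⟨k', hk', hke⟩ := longest_conj cs hw hk
    have : MulAut.conj w (cs.simple k) = cs.simple k' := by
      rw [MulAut.conj_apply, longest_inv cs hw, hke]
    change MulAut.conj w (cs.simple k) ∈ par cs (K \ {s'})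
    rw [this]
    refine simple_mem_par cs ⟨hk', fun h => hks ?_⟩
    have h' : k' = s' := h
    rw [h', he] at hke
    exact (simple_inj cs (mul_left_cancel (mul_right_cancel hke))).symm
  have := hle hv
  change MulAut.conj w v ∈ par cs (K \ {s'}) at this
  rwa [MulAut.conj_apply, longest_inv cs hw] at this

/-- Extending an expression by one atom. -/
theorem extend_expr (cs : CoxeterSystem M W) {I L J : Set B} {m : ℕ} (E : RAtomExpr cs I L m)
    {k s : B} {wK wJ : W} (hk : k ∉ L) (hfin : Finitary cs (L ∪ {k}))
    (hwK : IsLongest cs (L ∪ {k}) wK) (ht : cs.simple s = wK * cs.simple k * wK)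
    (hJ : J = (L ∪ {k}) \ {s}) (hwJ : IsLongest cs J wJ)
    (hred : (cs.length (E.x m * E.wL m * wK) : ℤ) =
      (cs.length (E.x m) : ℤ) - cs.length (E.wL m) + cs.length wK) :
    ∃ E' : RAtomExpr cs I J (m + 1), E'.tletter (m + 1) = s ∧
      E'.x (m + 1) = E.x m * E.wL m * wK := by
  have hcase : ∀ i, i ≤ m + 1 → i ≤ m ∨ i = m + 1 := fun i hi => by omega
  have hne : ¬ (m + 1 ≤ m) := by omega
  refine ⟨{
    Lset := fun i => if i ≤ m then E.Lset i else J
    letter := fun i => if i ≤ m then E.letter i else k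
    tletter := fun i => if i ≤ m then E.tletter i else s
    wL := fun i => if i ≤ m then E.wL i else wJ
    wK := fun i => if i ≤ m then E.wK i else wK
    x := fun i => if i ≤ m then E.x i else E.x m * E.wL m * wK
    hL0 := by simp [E.hL0]
    hLm := by simp
    hwL := ?_
    hmem := ?_
    hfinK := ?_
    hwK := ?_
    ht := ?_
    hLi := ?_
    hx0 := by simp [E.hx0]
    hx := ?_
    hred := ?_ }, by simp, by simp⟩
  · intro i hi
    rcases hcase i hi with h | rfl
    · simpa [h] using E.hwL i h
    · simpa using hwJ
  · intro i h1 hi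
    rcases hcase i hi with h | rfl
    · have h' : i - 1 ≤ m := by omega
      simpa [h, h'] using E.hmem i h1 h
    · simpa [E.hLm] using hk
  · intro i h1 hi
    rcases hcase i hi with h | rfl
    · have h' : i - 1 ≤ m := by omega
      simpa only [h, h', if_true] using E.hfinK i h1 h
    · simpa only [hne, if_false, Nat.add_sub_cancel, le_refl, if_true, E.hLm] using hfin
  · intro i h1 hi
    rcases hcase i hi with h | rfl
    · have h' : i - 1 ≤ m := by omega
      simpa only [h, h', if_true] using E.hwK i h1 h
    · simpa only [hne, if_false, Nat.add_sub_cancel, le_refl, if_true, E.hLm] using hwK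
  · intro i h1 hi
    rcases hcase i hi with h | rfl
    · simpa only [h, if_true] using E.ht i h1 h
    · simpa only [hne, if_false] using ht
  · intro i h1 hi
    rcases hcase i hi with h | rfl
    · have h' : i - 1 ≤ m := by omega
      simpa only [h, h', if_true] using E.hLi i h1 h
    · simpa only [hne, if_false, Nat.add_sub_cancel, le_refl, if_true, E.hLm] using hJ
  · intro i h1 hi
    rcases hcase i hi with h | rfl
    · have h' : i - 1 ≤ m := by omega
      simpa only [h, h', if_true] using E.hx i h1 h
    · simp only [hne, if_false, Nat.add_sub_cancel, le_refl, if_true]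
  · intro i h1 hi
    rcases hcase i hi with h | rfl
    · have h' : i - 1 ≤ m := by omega
      simpa only [h, h', if_true] using E.hred i h1 h
    · simpa only [hne, if_false, Nat.add_sub_cancel, le_refl, if_true] using hred

/-- The inductive step: peel off the last atom removing `s`. -/
theorem expr_step (cs : CoxeterSystem M W) {I J : Set B} {x wJ : W} {s : B}
    (hJ : Finitary cs J) (h : Cor cs I x J) (hwJ : IsLongest cs J wJ)
    (hs : cs.length (x * cs.simple s) < cs.length x)
    (ih : ∀ (y : W) (L : Set B) (wL : W), cs.length y < cs.length x → Finitary cs L →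
      IsLongest cs L wL → Cor cs I y L →
      ∃ (m : ℕ) (E : RAtomExpr cs I L m), E.x m = y * wL) :
    ∃ m : ℕ, 1 ≤ m ∧ ∃ E : RAtomExpr cs I J m, E.tletter m = s ∧ E.x m = x * wJ := by
  have hsJ := not_mem_of_descent cs h hs
  have hdesc := cor_descents cs h hwJ hs
  set K : Set B := J ∪ {s} with hKdef
  have hsK : s ∈ K := Or.inr rfl
  have hJK : J = K \ {s} := by
    ext k
    simp only [hKdef, Set.mem_diff, Set.mem_union, Set.mem_singleton_iff]
    constructor
    · intro hk; exact ⟨Or.inl hk, fun e => hsJ (e ▸ hk)⟩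
    · rintro ⟨hk | hk, hn⟩
      · exact hk
      · exact absurd hk hn
  have hsub : ∀ v ∈ par cs K, cs.length (x * wJ * v) + cs.length v = cs.length (x * wJ) :=
    fun v hv => sub_of_descents cs hdesc hv
  have hKfin : Finitary cs K := by
    refine finitary_of_bounded cs ((finite_of_finitary cs hJ).union (Set.finite_singleton s))
      (cs.length (x * wJ)) (fun v hv => ?_)
    have := hsub v hv
    omega
  obtain ⟨wK, hwK⟩ := exists_longest cs hKfin
  obtain ⟨k, hk, hke⟩ := longest_conj cs hwK hsK
  have hww := longest_mul_self cs hwK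
  have hJJ := longest_mul_self cs hwJ
  have hwJK : wJ ∈ par cs K := par_mono cs (by simp [hKdef]) hwJ.1
  have hse : cs.simple s = wK * cs.simple k * wK := by
    rw [hke]
    calc cs.simple s = (wK * wK) * cs.simple s * (wK * wK) := by simp [hww]
      _ = _ := by simp only [mul_assoc]
  set L : Set B := K \ {k} with hLdef
  have hLK : L ∪ {k} = K := by
    rw [hLdef, Set.diff_union_self]
    exact Set.union_eq_left.mpr (by simpa using hk)
  have hkL : k ∉ L := by simp [hLdef]
  have hLsub : L ⊆ K := Set.diff_subset
  have hLfin : Finitary cs L := hKfin.subset (par_mono cs hLsub)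
  obtain ⟨wL, hwL⟩ := exists_longest cs hLfin
  -- the new minimal element
  set y := x * wJ * wK with hy
  have hyl : cs.length y + cs.length wK = cs.length (x * wJ) := hsub _ hwK.1
  have hyadd : ∀ v ∈ par cs K, cs.length (y * v) = cs.length y + cs.length v := by
    intro v hv
    have h1 := hsub _ (Subgroup.mul_mem _ hwK.1 hv)
    have h2 := longest_sub cs hwK hv
    rw [← mul_assoc] at h1
    rw [hy] at *
    omega
  have hyK : y * wK = x * wJ := by rw [hy, mul_assoc, hww, mul_one]
  have hlt : cs.length wJ < cs.length wK := by
    by_contra hcon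
    have e := longest_unique cs hwK hwJK (by omega)
    have hyx : y = x := by rw [hy, ← e, mul_assoc, hJJ, mul_one]
    have h1 := hyadd _ (simple_mem_par cs hsK)
    rw [hyx] at h1
    omega
  have hxw := h.1 _ hwJ.1
  have hylt : cs.length y < cs.length x := by omega
  have hcor : Cor cs I y L := by
    have hinv := longest_inv cs hwK
    have hinvJ := longest_inv cs hwJ
    refine ⟨fun v hv => hyadd v (par_mono cs hLsub hv), fun v hv => ?_, fun u hu => ?_⟩
    · have h1 := conj_par cs hwK hse hv
      rw [← hJK] at h1
      have h2 := h.2.1 _ (Subgroup.mul_mem _ (Subgroup.mul_mem _ hwJ.1 h1) hwJ.1)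
      have e : y * v * y⁻¹ = x * (wJ * (wK * v * wK) * wJ) * x⁻¹ := by
        rw [hy, mul_inv_rev, mul_inv_rev, hinv, hinvJ]
        simp only [mul_assoc]
      rwa [e]
    · have h1 := h.2.2 u hu
      have h2 := Subgroup.mul_mem _ (Subgroup.mul_mem _ hwJ.1 h1) hwJ.1
      rw [hJK] at h2
      have h3 := conj_par cs hwK hke h2
      have e : y⁻¹ * u * y = wK * (wJ * (x⁻¹ * u * x) * wJ) * wK := by
        rw [hy, mul_inv_rev, mul_inv_rev, hinv, hinvJ]
        simp only [mul_assoc]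
      rwa [e]
  obtain ⟨m, E, hE⟩ := ih y L wL hylt hLfin hwL hcor
  have hEw : E.wL m = wL := by
    have hl := E.hwL m le_rfl
    rw [E.hLm] at hl
    exact longest_unique cs hwL hl.1 (hl.2 _ hwL.1)
  have hprod : E.x m * E.wL m * wK = x * wJ := by
    rw [hE, hEw, mul_assoc y, longest_mul_self cs hwL, mul_one, hyK]
  have hyL : cs.length (y * wL) = cs.length y + cs.length wL :=
    hyadd _ (par_mono cs hLsub hwL.1)
  obtain ⟨E', h1, h2⟩ := extend_expr cs E (k := k) (s := s) (wK := wK) (wJ := wJ) (J := J) hkL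
    (by rw [hLK]; exact hKfin) (by rw [hLK]; exact hwK) hse (by rw [hLK]; exact hJK) hwJ
    (by rw [hprod, hE, hEw]; omega)
  exact ⟨m + 1, by omega, E', h1, by rw [h2, hprod]⟩

theorem expr_exists (cs : CoxeterSystem M W) {I : Set B} (b₀ : B) (n : ℕ) :
    ∀ (x : W) (J : Set B) (wJ : W), cs.length x = n → Finitary cs J →
      IsLongest cs J wJ → Cor cs I x J →
      ∃ (m : ℕ) (E : RAtomExpr cs I J m), E.x m = x * wJ := by
  induction n using Nat.strong_induction_on with
  | _ n ih =>
    intro x J wJ hn hJ hwJ h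
    by_cases hx : x = 1
    · subst hx
      have hIJ : I = J := by
        ext k
        constructor
        · intro hk
          apply mem_of_simple_mem_par cs
          simpa using h.2.2 _ (simple_mem_par cs hk)
        · intro hk
          apply mem_of_simple_mem_par cs
          simpa using h.2.1 _ (simple_mem_par cs hk)
      subst hIJ
      refine ⟨0, {
        Lset := fun _ => I
        letter := fun _ => b₀
        tletter := fun _ => b₀
        wL := fun _ => wJ
        wK := fun _ => wJ
        x := fun _ => wJ
        hL0 := rfl
        hLm := rfl
        hwL := fun _ _ => hwJ
        hmem := fun i _ _ => by omega
        hfinK := fun i _ _ => by omega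
        hwK := fun i _ _ => by omega
        ht := fun i _ _ => by omega
        hLi := fun i _ _ => by omega
        hx0 := rfl
        hx := fun i _ _ => by omega
        hred := fun i _ _ => by omega }, by simp⟩
    · obtain ⟨s, hs⟩ := cs.exists_rightDescent_of_ne_one hx
      obtain ⟨m, _, E, _, hE⟩ := expr_step cs hJ h hwJ hs
        (fun y L wL hy hL hwL hc => ih (cs.length y) (hn ▸ hy) y L wL rfl hL hwL hc)
      exact ⟨m, E, hE⟩

end Core

theorem statement_9 (cs : CoxeterSystem M W) (I J : Set B)
    (hI : Finitary cs I) (hJ : Finitary cs J)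
    (qm qbar : W) (hqmin : IsMinRep cs I qm J) (hqcore : IsCore cs I qm J)
    (hqmax : IsMaxOf cs (dcos cs I qm J) qbar)
    (s : B) (hsJ : s ∉ J) (hJs : Finitary cs (J ∪ {s}))
    (wJ wJs : W) (hwJ : IsLongest cs J wJ) (hwJs : IsLongest cs (J ∪ {s}) wJs)
    (hnred : (cs.length (qbar * wJ * wJs) : ℤ) <
      (cs.length qbar : ℤ) - cs.length wJ + cs.length wJs) :
    cs.length (qm * cs.simple s) < cs.length qm ∧
    (∃ w ∈ dcos cs I qm (J ∪ {s}), cs.length w < cs.length qm) ∧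
    (∃ m : ℕ, 1 ≤ m ∧ ∃ E : RAtomExpr cs I J m, E.tletter m = s ∧ E.x m = qbar) := by
  have hcor := cor_of_core cs hqmin hqcore
  have hKJ := longest_mul_self cs hwJ
  have hq : qbar = qm * wJ := by
    have h1 := hqmax.1
    rw [hqcore.2] at h1
    obtain ⟨b, hb, he⟩ := h1
    have h2 := hqmax.2 (qm * wJ) ⟨1, Subgroup.one_mem _, wJ, hwJ.1, by simp⟩
    rw [he, hcor.1 _ hb, hcor.1 _ hwJ.1] at h2
    rw [he, longest_unique cs hwJ hb (by omega)]
  have hs : cs.length (qm * cs.simple s) < cs.length qm := by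
    by_contra hcon
    have hne := cs.length_mul_simple_ne qm s
    have hadd := add_of_localMin cs (K := J ∪ {s}) (x := qm) (by
      rintro k (hk | hk)
      · have := hcor.1 _ (simple_mem_par cs hk)
        rw [this, cs.length_simple]; omega
      · rw [Set.mem_singleton_iff.mp hk]; omega) hwJs.1
    have h1 := hcor.1 _ hwJ.1
    rw [hq, mul_assoc qm, hKJ, mul_one] at hnred
    omega
  refine ⟨hs, ⟨qm * cs.simple s, ⟨1, Subgroup.one_mem _, cs.simple s,
    simple_mem_par cs (Or.inr rfl), by simp⟩, hs⟩, ?_⟩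
  rw [hq]
  exact expr_step cs hJ hcor hwJ hs
    (fun y L wL _ hL hwL hc => expr_exists cs s _ y L wL rfl hL hwL hc)

end CoxeterAtoms
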